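/- Let f : ℝ^d → ℝ^d, ℓ : ℝ^d → ℝ, and g : ℝ^d → ℝ^{d×m} be continuous, R an m×m symmetric positive definite real matrix, and U ⊆ ℝ^m a nonempty closed convex set. Let V₀, V₁ : ℝ^d → ℝ be continuously differentiable with V₀(0) = V₁(0) = 0, let u₀ : ℝ^d → U be continuous, and define u₁(z) := P_U(−(1/2)R⁻¹g(z)ᵀ∇V₀(z)). Assume the GHJB equations ∇V₀(z)ᵀ(f(z) + g(z)u₀(z)) + ℓ(z) + ‖u₀(z)‖_R² = 0 and ∇V₁(z)ᵀ(f(z) + g(z)u₁(z)) + ℓ(z) + ‖u₁(z)‖_R² = 0 hold for all z ∈ ℝ^d. Let y : [0,∞) → ℝ^d be differentiable with y′(t) = f(y(t)) + g(y(t))u₁(y(t)), y(0) = x, lim_{t→∞} y(t) = 0, and suppose t ↦ ℓ(y(t)) + ‖u₀(y(t))‖_R² and t ↦ ℓ(y(t)) + ‖u₁(y(t))‖_R² are Lebesgue integrable on [0,∞). Then V₁(x) + ∫₀^∞ ‖u₁(y(t)) − u₀(y(t))‖_R² dt ≤ V₀(x); in particular V₁(x) ≤ V₀(x). -/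

import Mathlib

open Matrix MeasureTheory Filter

/-- The R-weighted squared norm `uᵀRu`. -/
def rnormSq {m : ℕ} (R : Matrix (Fin m) (Fin m) ℝ) (u : Fin m → ℝ) : ℝ :=
  u ⬝ᵥ R.mulVec u

/-- `p` is the R-projection of `v` onto `U`: `p ∈ U` and `p` minimizes the
R-weighted distance to `v` over `U`. -/
def IsRProj {m : ℕ} (R : Matrix (Fin m) (Fin m) ℝ) (U : Set (Fin m → ℝ))
    (v p : Fin m → ℝ) : Prop :=
  p ∈ U ∧ ∀ w ∈ U, rnormSq R (v - p) ≤ rnormSq R (v - w)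

theorem rnormSq_nonneg {m : ℕ} {R : Matrix (Fin m) (Fin m) ℝ} (hR : R.PosDef)
    (u : Fin m → ℝ) : 0 ≤ rnormSq R u := by
  simpa [rnormSq] using hR.posSemidef.dotProduct_mulVec_nonneg u

theorem dotProduct_mulVec_symm {m : ℕ} {R : Matrix (Fin m) (Fin m) ℝ} (hR : R.PosDef)
    (u v : Fin m → ℝ) : u ⬝ᵥ R.mulVec v = v ⬝ᵥ R.mulVec u := by
  have hT : Rᵀ = R := by simpa using hR.isHermitian.eq
  rw [dotProduct_mulVec, ← mulVec_transpose, hT, dotProduct_comm]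

theorem rnormSq_sub {m : ℕ} {R : Matrix (Fin m) (Fin m) ℝ} (hR : R.PosDef)
    (u v : Fin m → ℝ) :
    rnormSq R (u - v) = rnormSq R u - 2 * (u ⬝ᵥ R.mulVec v) + rnormSq R v := by
  have h := dotProduct_mulVec_symm hR v u
  simp only [rnormSq, mulVec_sub, dotProduct_sub, sub_dotProduct]
  linarith

theorem rnormSq_smul {m : ℕ} (R : Matrix (Fin m) (Fin m) ℝ) (s : ℝ) (u : Fin m → ℝ) :
    rnormSq R (s • u) = s ^ 2 * rnormSq R u := by
  simp only [rnormSq, mulVec_smul, dotProduct_smul, smul_dotProduct, smul_eq_mul]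
  ring

/-- The variational inequality characterizing the projection onto a convex set. -/
theorem IsRProj.inner_le_zero {m : ℕ} {R : Matrix (Fin m) (Fin m) ℝ} (hR : R.PosDef)
    {U : Set (Fin m → ℝ)} (hU : Convex ℝ U) {v p w : Fin m → ℝ} (hp : IsRProj R U v p)
    (hw : w ∈ U) : (v - p) ⬝ᵥ R.mulVec (w - p) ≤ 0 := by
  by_contra! hc
  set c := (v - p) ⬝ᵥ R.mulVec (w - p) with hcdef
  have hn := rnormSq_nonneg hR (w - p)
  set n := rnormSq R (w - p) with hndef
  have hs : 0 < c / (c + n) := by positivity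
  have hs1 : c / (c + n) ≤ 1 := by
    rw [div_le_one (by positivity)]
    linarith
  have hsn : c / (c + n) * (c + n) = c := div_mul_cancel₀ _ (by positivity)
  set s := c / (c + n)
  have h := hp.2 _ (hU.add_smul_sub_mem hp.1 hw ⟨hs.le, hs1⟩)
  rw [← sub_sub, rnormSq_sub hR (v - p), rnormSq_smul, mulVec_smul, dotProduct_smul,
    smul_eq_mul, ← hcdef, ← hndef] at h
  nlinarith [mul_pos hs hc, mul_pos hs hs, mul_pos (mul_pos hs hs) hc]

/-- The projected policy update decreases the Hamiltonian by at least the squared distance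
between the two controls. -/
theorem IsRProj.hamiltonian_le {d m : ℕ} {R : Matrix (Fin m) (Fin m) ℝ} (hR : R.PosDef)
    {U : Set (Fin m → ℝ)} (hU : Convex ℝ U) (G : Matrix (Fin d) (Fin m) ℝ) (q : Fin d → ℝ)
    {p w : Fin m → ℝ} (hp : IsRProj R U (-(1 / 2 : ℝ) • R⁻¹.mulVec (Gᵀ.mulVec q)) p)
    (hw : w ∈ U) :
    q ⬝ᵥ G.mulVec p + rnormSq R p + rnormSq R (p - w) ≤ q ⬝ᵥ G.mulVec w + rnormSq R w := by
  have key (b : Fin m → ℝ) : (-(1 / 2 : ℝ) • R⁻¹.mulVec (Gᵀ.mulVec q)) ⬝ᵥ R.mulVec b =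
      -(1 / 2) * (q ⬝ᵥ G.mulVec b) := by
    rw [dotProduct_mulVec_symm hR, mulVec_smul, mulVec_mulVec,
      mul_nonsing_inv _ ((isUnit_iff_isUnit_det _).1 hR.isUnit), one_mulVec, dotProduct_smul,
      smul_eq_mul, dotProduct_comm, mulVec_transpose, ← dotProduct_mulVec]
  have h := hp.inner_le_zero hR hU hw
  rw [sub_dotProduct, key] at h
  rw [rnormSq_sub hR]
  simp only [rnormSq, mulVec_sub, dotProduct_sub] at h ⊢
  linarith

/-- Policy improvement: if `(V₀, u₀)` and `(V₁, u₁)` solve the GHJB equations,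
where `u₁(z) = P_U(−(1/2)R⁻¹g(z)ᵀ∇V₀(z))` is the projected policy update, and
`y` is the closed-loop trajectory for `u₁` starting at `x` converging to `0`
with integrable running costs, then
`V₁(x) + ∫₀^∞ ‖u₁(y(t)) − u₀(y(t))‖_R² dt ≤ V₀(x)`. -/
theorem stmt11 {d m : ℕ}
    (f : (Fin d → ℝ) → (Fin d → ℝ)) (hf : Continuous f)
    (ℓ : (Fin d → ℝ) → ℝ) (hℓc : Continuous ℓ)
    (g : (Fin d → ℝ) → Matrix (Fin d) (Fin m) ℝ) (hg : Continuous g)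
    (R : Matrix (Fin m) (Fin m) ℝ) (hR : R.PosDef)
    (U : Set (Fin m → ℝ)) (hUne : U.Nonempty) (hUcl : IsClosed U) (hUco : Convex ℝ U)
    (V0 V1 : (Fin d → ℝ) → ℝ) (hV0 : ContDiff ℝ 1 V0) (hV1 : ContDiff ℝ 1 V1)
    (hV00 : V0 0 = 0) (hV10 : V1 0 = 0)
    (DV0 : (Fin d → ℝ) → (Fin d → ℝ))
    (hDV0 : ∀ z w, fderiv ℝ V0 z w = DV0 z ⬝ᵥ w)
    (u0 : (Fin d → ℝ) → (Fin m → ℝ)) (hu0c : Continuous u0) (hu0U : ∀ z, u0 z ∈ U)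
    (u1 : (Fin d → ℝ) → (Fin m → ℝ))
    (hu1 : ∀ z, IsRProj R U (-(1 / 2 : ℝ) • R⁻¹.mulVec ((g z)ᵀ.mulVec (DV0 z))) (u1 z))
    (hGHJB0 : ∀ z, DV0 z ⬝ᵥ (f z + (g z).mulVec (u0 z)) + ℓ z + rnormSq R (u0 z) = 0)
    (hGHJB1 : ∀ z, fderiv ℝ V1 z (f z + (g z).mulVec (u1 z)) + ℓ z + rnormSq R (u1 z) = 0)
    (x : Fin d → ℝ) (y : ℝ → (Fin d → ℝ))
    (hy : ∀ t, 0 ≤ t → HasDerivAt y (f (y t) + (g (y t)).mulVec (u1 (y t))) t)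
    (hy0 : y 0 = x)
    (hylim : Tendsto y atTop (nhds 0))
    (hint0 : IntegrableOn (fun t => ℓ (y t) + rnormSq R (u0 (y t))) (Set.Ici 0))
    (hint1 : IntegrableOn (fun t => ℓ (y t) + rnormSq R (u1 (y t))) (Set.Ici 0)) :
    V1 x + (∫ t in Set.Ioi (0 : ℝ), rnormSq R (u1 (y t) - u0 (y t))) ≤ V0 x ∧
      V1 x ≤ V0 x := by
  have hd (V : (Fin d → ℝ) → ℝ) (hV : ContDiff ℝ 1 V) (t : ℝ) (ht : 0 ≤ t) :
      HasDerivAt (fun t => V (y t))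
        (fderiv ℝ V (y t) (f (y t) + (g (y t)).mulVec (u1 (y t)))) t :=
    ((hV.differentiable one_ne_zero).differentiableAt.hasFDerivAt).comp_hasDerivAt t (hy t ht)
  have hlim (V : (Fin d → ℝ) → ℝ) (hV : ContDiff ℝ 1 V) (h0 : V 0 = 0) :
      Tendsto (fun t => V (y t)) atTop (nhds 0) := by
    simpa [h0, Function.comp_def] using (hV.continuous.tendsto 0).comp hylim
  let D : ℝ → ℝ := fun t =>
    fderiv ℝ V0 (y t) (f (y t) + (g (y t)).mulVec (u1 (y t))) -
      fderiv ℝ V1 (y t) (f (y t) + (g (y t)).mulVec (u1 (y t)))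
  have hD (t : ℝ) (ht : 0 ≤ t) : HasDerivAt (fun t => V0 (y t) - V1 (y t)) (D t) t :=
    (hd V0 hV0 t ht).sub (hd V1 hV1 t ht)
  have hW : Tendsto (fun t => V0 (y t) - V1 (y t)) atTop (nhds 0) := by
    simpa using (hlim V0 hV0 hV00).sub (hlim V1 hV1 hV10)
  have hDq (t : ℝ) : rnormSq R (u1 (y t) - u0 (y t)) ≤ -D t := by
    have h := (hu1 (y t)).hamiltonian_le hR hUco _ _ (hu0U (y t))
    have h0 := hGHJB0 (y t)
    have h1 := hGHJB1 (y t)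
    simp only [D]
    rw [hDV0]
    rw [dotProduct_add] at h0 ⊢
    linarith
  have hq (t : ℝ) : 0 ≤ rnormSq R (u1 (y t) - u0 (y t)) := rnormSq_nonneg hR _
  have hDneg (t : ℝ) : D t ≤ 0 := by linarith [hq t, hDq t]
  have hDint : IntegrableOn D (Set.Ioi 0) :=
    integrableOn_Ioi_deriv_of_nonpos' (fun t ht => hD t ht) (fun t _ => hDneg t) hW
  have hint : ∫ t in Set.Ioi (0 : ℝ), D t = V1 x - V0 x := by
    rw [integral_Ioi_of_hasDerivAt_of_tendsto' (fun t ht => hD t ht) hDint hW, hy0]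
    ring
  have hle : ∫ t in Set.Ioi (0 : ℝ), rnormSq R (u1 (y t) - u0 (y t)) ≤
      ∫ t in Set.Ioi (0 : ℝ), -D t :=
    integral_mono_of_nonneg (.of_forall hq) hDint.neg (.of_forall hDq)
  have hnn : 0 ≤ ∫ t in Set.Ioi (0 : ℝ), rnormSq R (u1 (y t) - u0 (y t)) :=
    integral_nonneg hq
  rw [integral_neg, hint] at hle
  constructor <;> linarith
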